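/- Let m ≥ 1 be an integer and define for real t (with t ∉ {2m+1,…,3m} and t ∉ {−m,…,−1}) the rational function s(t) = (1/(2m+1)!) · ∑_{i=2m+1}^{3m} ( (i!)² (−1)^{i+m} / ( ((i−2m−1)!)² (3m−i)! (i+m)! ) ) · ( 1/(t−i) − 1/(t−2m+i) ). Then for every real t such that t, t−1 and t−2 all avoid the pole set {2m+1,…,3m} ∪ {−m,…,−1}, one has s(t)·(m+t)·(2m+1−t)² = 2(m+1−t)(2m²+2tm−2−t²+2t)·s(t−1) + (t−1)²(3m+2−t)·s(t−2). -/

import Mathlib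

open Finset

/-- The rational function `s(t)` from the proof of Proposition `interp-2`. -/
noncomputable def sfun (m : ℕ) (t : ℝ) : ℝ :=
  (1 / (Nat.factorial (2 * m + 1) : ℝ)) *
    ∑ i ∈ Finset.Icc (2 * m + 1) (3 * m),
      ((Nat.factorial i : ℝ) ^ 2 * (-1 : ℝ) ^ (i + m)
        / ((Nat.factorial (i - (2 * m + 1)) : ℝ) ^ 2
            * (Nat.factorial (3 * m - i) : ℝ) * (Nat.factorial (i + m) : ℝ)))
      * (1 / (t - (i : ℝ)) - 1 / (t - 2 * m + (i : ℝ)))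

/-- The coefficient of the `i`-th summand of `sfun m`. -/
noncomputable def sfunCoeff (m i : ℕ) : ℝ :=
  (Nat.factorial i : ℝ) ^ 2 * (-1 : ℝ) ^ (i + m)
    / ((Nat.factorial (i - (2 * m + 1)) : ℝ) ^ 2
        * (Nat.factorial (3 * m - i) : ℝ) * (Nat.factorial (i + m) : ℝ))

/-- The contribution of the kernel `1/(t-x) - 1/(t-2m+x)` to the difference of the two sides of
the recursion. -/
noncomputable def kernelDefect (m t x : ℝ) : ℝ :=
  (1 / (t - x) - 1 / (t - 2 * m + x)) * (m + t) * (2 * m + 1 - t) ^ 2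
    - 2 * (m + 1 - t) * (2 * m ^ 2 + 2 * t * m - 2 - t ^ 2 + 2 * t)
      * (1 / (t - 1 - x) - 1 / (t - 1 - 2 * m + x))
    - (t - 1) ^ 2 * (3 * m + 2 - t) * (1 / (t - 2 - x) - 1 / (t - 2 - 2 * m + x))

/-- The rational factor of the telescoping certificate. -/
noncomputable def certificate (m t x : ℝ) : ℝ :=
  2 * (t - m - 1) * (2 * x - 2 * m - 1)
    / ((t - x) * (t - 1 - x) * (t - 1 - 2 * m + x) * (t - 2 - 2 * m + x))

lemma sfunCoeff_succ (m i : ℕ) (h₁ : 2 * m + 1 ≤ i) (h₂ : i + 1 ≤ 3 * m) :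
    sfunCoeff m (i + 1) * (((i : ℝ) - 2 * m) ^ 2 * (i + 1 + m))
      = -(sfunCoeff m i * ((i + 1) ^ 2 * (3 * m - i))) := by
  obtain ⟨j, rfl⟩ := Nat.exists_eq_add_of_le h₁
  obtain ⟨k, hk⟩ := Nat.exists_eq_add_of_le h₂
  have hm : m = j + 2 + k := by omega
  have e₁ : 2 * m + 1 + j + 1 - (2 * m + 1) = j + 1 := by omega
  have e₂ : 2 * m + 1 + j - (2 * m + 1) = j := by omega
  have e₃ : 3 * m - (2 * m + 1 + j + 1) = k := by omega
  have e₄ : 3 * m - (2 * m + 1 + j) = k + 1 := by omega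
  have e₅ : 2 * m + 1 + j + 1 + m = (2 * m + 1 + j + m) + 1 := by omega
  have hmR : (m : ℝ) = j + 2 + k := by exact_mod_cast hm
  have hk' : 3 * (m : ℝ) - (2 * m + 1 + j) = k + 1 := by rw [hmR]; ring
  have hj : (2 * (m : ℝ) + 1 + j) - 2 * m = j + 1 := by ring
  unfold sfunCoeff
  rw [e₁, e₂, e₃, e₄, e₅]
  simp only [Nat.factorial_succ (2 * m + 1 + j), Nat.factorial_succ (2 * m + 1 + j + m),
    Nat.factorial_succ j, Nat.factorial_succ k, pow_succ (-1 : ℝ) (2 * m + 1 + j + m)]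
  push_cast
  rw [hk', hj]
  have f₁ : (Nat.factorial j : ℝ) ≠ 0 := by positivity
  have f₂ : (Nat.factorial k : ℝ) ≠ 0 := by positivity
  have f₃ : (Nat.factorial (2 * m + 1 + j + m) : ℝ) ≠ 0 := by positivity
  have f₄ : (j : ℝ) + 1 ≠ 0 := by positivity
  have f₅ : (k : ℝ) + 1 ≠ 0 := by positivity
  have f₆ : 2 * (m : ℝ) + 1 + j + m + 1 ≠ 0 := by positivity
  have f₇ : 2 * (m : ℝ) + 1 + j + 1 + m ≠ 0 := by positivity
  field_simp
  ring

lemma kernelDefect_eq (m t x : ℝ)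
    (h₀ : t - x ≠ 0) (h₁ : t - 1 - x ≠ 0) (h₂ : t - 2 - x ≠ 0)
    (k₀ : t - 2 * m + x ≠ 0) (k₁ : t - 1 - 2 * m + x ≠ 0) (k₂ : t - 2 - 2 * m + x ≠ 0) :
    kernelDefect m t x
      = -((x + 1) ^ 2 * (3 * m - x)) * certificate m t (x + 1)
        - (x - 2 * m - 1) ^ 2 * (x + m) * certificate m t x := by
  have e₁ : t - (x + 1) = t - 1 - x := by ring
  have e₂ : t - 1 - (x + 1) = t - 2 - x := by ring
  have e₃ : t - 1 - 2 * m + (x + 1) = t - 2 * m + x := by ring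
  have e₄ : t - 2 - 2 * m + (x + 1) = t - 1 - 2 * m + x := by ring
  unfold kernelDefect certificate
  rw [e₁, e₂, e₃, e₄]
  field_simp
  ring

lemma sum_sfunCoeff_mul_kernelDefect (m : ℕ) (t : ℝ)
    (ht : ∀ u ∈ ({t, t - 1, t - 2} : Set ℝ), ∀ i ∈ Finset.Icc (2 * m + 1) (3 * m),
      u ≠ (i : ℝ) ∧ u ≠ 2 * m - (i : ℝ))
    (n : ℕ) (hn : 2 * m + 1 ≤ n) (hn' : n ≤ 3 * m) :
    ∑ i ∈ Finset.Icc (2 * m + 1) n, sfunCoeff m i * kernelDefect m t i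
      = -(sfunCoeff m n * (((n : ℝ) + 1) ^ 2 * (3 * m - n))) * certificate m t (n + 1) := by
  have hdefect : ∀ i : ℕ, 2 * m + 1 ≤ i → i ≤ 3 * m → kernelDefect m t i
      = -(((i : ℝ) + 1) ^ 2 * (3 * m - i)) * certificate m t (i + 1)
        - ((i : ℝ) - 2 * m - 1) ^ 2 * (i + m) * certificate m t i := by
    intro i hi hi'
    have hmem := Finset.mem_Icc.mpr ⟨hi, hi'⟩
    have a₀ := ht t (by simp) i hmem
    have a₁ := ht (t - 1) (by simp) i hmem
    have a₂ := ht (t - 2) (by simp) i hmem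
    apply kernelDefect_eq
    · exact sub_ne_zero.mpr a₀.1
    · exact sub_ne_zero.mpr a₁.1
    · exact sub_ne_zero.mpr a₂.1
    · exact fun h => a₀.2 (by linarith)
    · exact fun h => a₁.2 (by linarith)
    · exact fun h => a₂.2 (by linarith)
  induction n, hn using Nat.le_induction with
  | base =>
    rw [Finset.Icc_self, Finset.sum_singleton, hdefect _ le_rfl hn']
    push_cast
    ring
  | succ n hn ih =>
    rw [Finset.sum_Icc_succ_top (by omega), ih (by omega), hdefect _ (by omega) hn',
      ← sfunCoeff_succ m n hn hn']
    push_cast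
    ring

/-- The recursion
`s(t)(m+t)(2m+1−t)² = 2(m+1−t)(2m²+2tm−2−t²+2t) s(t−1) + (t−1)²(3m+2−t) s(t−2)`,
valid whenever `t`, `t-1`, `t-2` avoid the pole set `{2m+1,…,3m} ∪ {−m,…,−1}`. -/
theorem stmt_3 (m : ℕ) (hm : 1 ≤ m) (t : ℝ)
    (ht : ∀ u ∈ ({t, t - 1, t - 2} : Set ℝ), ∀ i ∈ Finset.Icc (2 * m + 1) (3 * m),
      u ≠ (i : ℝ) ∧ u ≠ 2 * m - (i : ℝ)) :
    sfun m t * (m + t) * (2 * m + 1 - t) ^ 2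
      = 2 * (m + 1 - t) * (2 * m ^ 2 + 2 * t * m - 2 - t ^ 2 + 2 * t) * sfun m (t - 1)
        + (t - 1) ^ 2 * (3 * m + 2 - t) * sfun m (t - 2) := by
  have hsum := sum_sfunCoeff_mul_kernelDefect m t ht (3 * m) (by omega) le_rfl
  have hzero : ∑ i ∈ Finset.Icc (2 * m + 1) (3 * m), sfunCoeff m i * kernelDefect m t i = 0 := by
    rw [hsum]
    push_cast
    ring
  have hs : ∀ u : ℝ, sfun m u = (1 / (Nat.factorial (2 * m + 1) : ℝ)) *
      ∑ i ∈ Finset.Icc (2 * m + 1) (3 * m),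
        sfunCoeff m i * (1 / (u - (i : ℝ)) - 1 / (u - 2 * m + (i : ℝ))) := fun _ => rfl
  have hsplit : ∑ i ∈ Finset.Icc (2 * m + 1) (3 * m), sfunCoeff m i * kernelDefect m t i
      = (∑ i ∈ Finset.Icc (2 * m + 1) (3 * m),
          sfunCoeff m i * (1 / (t - (i : ℝ)) - 1 / (t - 2 * m + (i : ℝ))))
          * ((m + t) * (2 * m + 1 - t) ^ 2)
        - (∑ i ∈ Finset.Icc (2 * m + 1) (3 * m),
          sfunCoeff m i * (1 / (t - 1 - (i : ℝ)) - 1 / (t - 1 - 2 * m + (i : ℝ))))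
          * (2 * (m + 1 - t) * (2 * m ^ 2 + 2 * t * m - 2 - t ^ 2 + 2 * t))
        - (∑ i ∈ Finset.Icc (2 * m + 1) (3 * m),
          sfunCoeff m i * (1 / (t - 2 - (i : ℝ)) - 1 / (t - 2 - 2 * m + (i : ℝ))))
          * ((t - 1) ^ 2 * (3 * m + 2 - t)) := by
    simp only [Finset.sum_mul, ← Finset.sum_sub_distrib]
    refine Finset.sum_congr rfl fun i _ => ?_
    unfold kernelDefect
    ring
  rw [hs, hs, hs]
  linear_combination (1 / (Nat.factorial (2 * m + 1) : ℝ)) * (hzero - hsplit)
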